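/- For all positive integers m and n, the matrix M(m,n) satisfies |det M(m,n)| = m³ + 12m²n + 14mn², and every z ∈ ℤ³ is congruent modulo M(m,n) to some a ∈ ℕ³ with ‖a‖₁ ≤ max{m + 8n − 3, 3m + 4n − 3, 5m − 3}; that is, the Cayley digraph G_{M(m,n)} has order m³ + 12m²n + 14mn² and diameter at most max{m + 8n − 3, 3m + 4n − 3, 5m − 3}. -/

import Mathlib

/-- Congruence modulo the lattice `M·ℤ³`. -/
def MEq (M : Matrix (Fin 3) (Fin 3) ℤ) (a b : Fin 3 → ℤ) : Prop :=
  ∃ l : Fin 3 → ℤ, a - b = M.mulVec l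

/-- The matrix `M(m,n)` of Aguiló, Simó and Zaragozá. -/
def Mmn (m n : ℤ) : Matrix (Fin 3) (Fin 3) ℤ :=
  !![n, m, -2*m - 2*n;
     3*n + m, m, m + 2*n;
     2*n, -m, m + n]

/-- `(x, y, w)` cannot be decreased, with respect to the weights `(p, q, r)`, by subtracting a vector
of the lattice `M(m,n)·ℤ³` without leaving the nonnegative octant. -/
def IsLatticeReduced (m n p q r x y w : ℤ) : Prop :=
  ∀ i j k : ℤ,
    x < i * n + j * m + k * (-2 * m - 2 * n) ∨
    y < i * (3 * n + m) + j * m + k * (m + 2 * n) ∨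
    w < i * (2 * n) + j * (-m) + k * (m + n) ∨
    p * (i * n + j * m + k * (-2 * m - 2 * n)) + q * (i * (3 * n + m) + j * m + k * (m + 2 * n)) +
      r * (i * (2 * n) + j * (-m) + k * (m + n)) ≤ 0

theorem Mmn_det (m n : ℤ) : (Mmn m n).det = m ^ 3 + 12 * m ^ 2 * n + 14 * m * n ^ 2 := by
  simp [Mmn, Matrix.det_fin_three]
  ring

theorem MEq.sub_lattice {m n : ℤ} {a z : Fin 3 → ℤ} (h : MEq (Mmn m n) a z) (i j k : ℤ) :
    MEq (Mmn m n) ![a 0 - (i * n + j * m + k * (-2 * m - 2 * n)),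
      a 1 - (i * (3 * n + m) + j * m + k * (m + 2 * n)),
      a 2 - (i * (2 * n) + j * (-m) + k * (m + n))] z := by
  obtain ⟨l, hl⟩ := h
  refine ⟨l - ![i, j, k], ?_⟩
  rw [Matrix.mulVec_sub, ← hl]
  ext t
  fin_cases t <;> simp [Mmn] <;> ring

theorem exists_MEq_forall_ge {m n : ℤ} (hm : 1 ≤ m) (hn : 1 ≤ n) (z : Fin 3 → ℤ) (B : ℤ) :
    ∃ a : Fin 3 → ℤ, MEq (Mmn m n) a z ∧ B ≤ a 0 ∧ B ≤ a 1 ∧ B ≤ a 2 := by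
  have hz : MEq (Mmn m n) z z := ⟨0, by simp⟩
  set t := |B| + |z 0| + |z 1| + |z 2| with ht
  have hB := le_abs_self B
  have hB' := abs_nonneg B
  have h0 := neg_abs_le (z 0)
  have h1 := neg_abs_le (z 1)
  have h2 := neg_abs_le (z 2)
  have h0' := abs_nonneg (z 0)
  have h1' := abs_nonneg (z 1)
  have h2' := abs_nonneg (z 2)
  have htn : t ≤ t * n := le_mul_of_one_le_right (by omega) hn
  have htm : t ≤ t * m := le_mul_of_one_le_right (by omega) hm
  refine ⟨_, hz.sub_lattice (-t) 0 0, ?_, ?_, ?_⟩ <;> simp <;> linarith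

theorem exists_MEq_minimal {M : Matrix (Fin 3) (Fin 3) ℤ} {z : Fin 3 → ℤ}
    (S : (Fin 3 → ℤ) → Prop) (f : (Fin 3 → ℤ) → ℤ) (hf : ∀ a, S a → 0 ≤ f a)
    (hS : ∃ a, MEq M a z ∧ S a) :
    ∃ a, MEq M a z ∧ S a ∧ ∀ b, MEq M b z → S b → f a ≤ f b := by
  obtain ⟨a, ⟨haz, haS⟩, hmin⟩ :=
    (measure fun a => (f a).toNat).wf.has_min {a | MEq M a z ∧ S a} hS
  refine ⟨a, haz, haS, fun b hbz hbS => ?_⟩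
  have hab : ¬ (f b).toNat < (f a).toNat := hmin b ⟨hbz, hbS⟩
  have := hf a haS
  have := hf b hbS
  omega

theorem exists_MEq_isLatticeReduced {m n : ℤ} (hm : 1 ≤ m) (hn : 1 ≤ n) (z : Fin 3 → ℤ)
    {p q r : ℤ} (hp : 0 ≤ p) (hq : 0 ≤ q) (hr : 0 ≤ r) :
    ∃ a : Fin 3 → ℤ, MEq (Mmn m n) a z ∧ 0 ≤ a 0 ∧ 0 ≤ a 1 ∧ 0 ≤ a 2 ∧
      IsLatticeReduced m n p q r (a 0) (a 1) (a 2) := by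
  obtain ⟨a, haz, ⟨h0, h1, h2⟩, hmin⟩ :=
    exists_MEq_minimal (fun a => 0 ≤ a 0 ∧ 0 ≤ a 1 ∧ 0 ≤ a 2)
      (fun a => p * a 0 + q * a 1 + r * a 2) (fun a ⟨_, _, _⟩ => by positivity)
      (exists_MEq_forall_ge hm hn z 0)
  refine ⟨a, haz, h0, h1, h2, fun i j k => ?_⟩
  by_contra! hlt
  obtain ⟨hx, hy, hw, hpos⟩ := hlt
  have := hmin _ (haz.sub_lattice i j k)
    ⟨sub_nonneg.2 hx, sub_nonneg.2 hy, sub_nonneg.2 hw⟩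
  simp only [Matrix.cons_val] at this
  linarith

/-- For `m ≤ n`, reduce first modulo the second column `(m, m, -m)`, on which `x + w` and `y + w`
vanish, so that the problem becomes one about a planar lattice. -/
theorem exists_MEq_of_le {m n : ℤ} (hm : 1 ≤ m) (hmn : m ≤ n) (z : Fin 3 → ℤ) :
    ∃ a : Fin 3 → ℤ, MEq (Mmn m n) a z ∧ 0 ≤ a 0 ∧ 0 ≤ a 1 ∧ 0 ≤ a 2 ∧
      a 0 + a 1 + a 2 ≤ m + 8 * n - 3 := by
  obtain ⟨b, hb, hb0, hb1, hb2⟩ := exists_MEq_forall_ge hm (hm.trans hmn) z m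
  obtain ⟨a, haz, ⟨hP, hQ⟩, hmin⟩ :=
    exists_MEq_minimal (fun a => m - 1 ≤ a 0 + a 2 ∧ m - 1 ≤ a 1 + a 2)
      (fun a => a 0 + a 1 + 2 * a 2) (fun a ⟨_, _⟩ => by omega)
      ⟨b, hb, by omega, by omega⟩
  have hQlt : a 1 + a 2 ≤ 3 * m + 3 * n - 2 := by
    by_contra hlt
    have := hmin _ (haz.sub_lattice 0 0 1)
    simp only [Matrix.cons_val] at this
    omega
  have hPlt : a 0 + a 2 ≤ 3 * m + 5 * n - 2 := by
    by_contra hlt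
    have := hmin _ (haz.sub_lattice 1 0 (-2))
    simp only [Matrix.cons_val] at this
    omega
  rcases le_total (a 0) (a 1) with hle | hle
  · have hmod := Int.emod_nonneg (a 0) (by omega : m ≠ 0)
    have hlt := Int.emod_lt_of_pos (a 0) (by omega : 0 < m)
    have hdiv := Int.emod_add_ediv_mul (a 0) m
    refine ⟨_, haz.sub_lattice 0 (a 0 / m) 0, ?_⟩
    simp only [Matrix.cons_val]
    refine ⟨?_, ?_, ?_, ?_⟩ <;> linarith
  · have hmod := Int.emod_nonneg (a 1) (by omega : m ≠ 0)
    have hlt := Int.emod_lt_of_pos (a 1) (by omega : 0 < m)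
    have hdiv := Int.emod_add_ediv_mul (a 1) m
    refine ⟨_, haz.sub_lattice 0 (a 1 / m) 0, ?_⟩
    simp only [Matrix.cons_val]
    refine ⟨?_, ?_, ?_, ?_⟩ <;> linarith

theorem IsLatticeReduced.sum_le_of_ratio_le_five_thirds {m n x y w : ℤ} (hn : 1 ≤ n) (h₁ : n ≤ m) (h₂ : 3 * m ≤ 5 * n)
    (hx : 0 ≤ x) (hy : 0 ≤ y) (hw : 0 ≤ w) (h : IsLatticeReduced m n 9 8 8 x y w) :
    x + y + w ≤ m + 8 * n - 3 := by
  by_contra hc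
  rcases h 0 1 0 with g | g | g | g <;> try omega
  all_goals (rcases h 0 1 (-1) with g | g | g | g <;> try omega)
  all_goals (rcases h 0 2 1 with g | g | g | g <;> try omega)
  all_goals (rcases h 0 0 1 with g | g | g | g <;> try omega)
  all_goals (rcases h 1 (-4) 0 with g | g | g | g <;> try omega)
  all_goals (rcases h 1 (-2) 0 with g | g | g | g <;> try omega)
  all_goals (rcases h 1 (-2) (-1) with g | g | g | g <;> try omega)
  all_goals (rcases h 1 (-3) 0 with g | g | g | g <;> try omega)
  all_goals (rcases h 1 (-3) (-1) with g | g | g | g <;> try omega)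
  all_goals (rcases h 1 (-1) (-1) with g | g | g | g <;> try omega)
  all_goals (rcases h 0 1 1 with g | g | g | g <;> try omega)
  all_goals (rcases h 1 (-1) 0 with g | g | g | g <;> try omega)

theorem IsLatticeReduced.sum_le_of_ratio_le_five_halves {m n x y w : ℤ} (hn : 1 ≤ n) (h₁ : 5 * n ≤ 3 * m) (h₂ : 2 * m ≤ 5 * n)
    (hx : 0 ≤ x) (hy : 0 ≤ y) (hw : 0 ≤ w) (h : IsLatticeReduced m n 9 8 8 x y w) :
    x + y + w ≤ max (m + 8 * n - 3) (5 * m - 3) := by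
  by_contra hc
  rcases h 0 1 0 with g | g | g | g <;> try omega
  all_goals (rcases h 0 1 (-1) with g | g | g | g <;> try omega)
  all_goals (rcases h 0 2 1 with g | g | g | g <;> try omega)
  all_goals (rcases h 0 0 1 with g | g | g | g <;> try omega)
  all_goals (rcases h 1 (-3) 0 with g | g | g | g <;> try omega)
  all_goals (rcases h 1 (-2) 0 with g | g | g | g <;> try omega)
  all_goals (rcases h 1 (-2) (-1) with g | g | g | g <;> try omega)
  all_goals (rcases h 1 (-3) (-1) with g | g | g | g <;> try omega)
  all_goals (rcases h 1 (-1) (-1) with g | g | g | g <;> try omega)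
  all_goals (rcases h 0 1 1 with g | g | g | g <;> try omega)
  all_goals (rcases h 1 (-1) 0 with g | g | g | g <;> try omega)
  all_goals (rcases h (-1) 4 1 with g | g | g | g <;> try omega)
  all_goals (rcases h 1 0 (-1) with g | g | g | g <;> try omega)
  all_goals (rcases h 1 0 0 with g | g | g | g <;> try omega)

theorem IsLatticeReduced.sum_le_of_ratio_le_four {m n x y w : ℤ} (hn : 1 ≤ n) (h₁ : 5 * n ≤ 2 * m) (h₂ : m ≤ 4 * n)
    (hx : 0 ≤ x) (hy : 0 ≤ y) (hw : 0 ≤ w) (h : IsLatticeReduced m n 17 16 16 x y w) :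
    x + y + w ≤ 5 * m - 3 := by
  by_contra hc
  rcases h 0 1 0 with g | g | g | g <;> try omega
  all_goals (rcases h 0 1 (-1) with g | g | g | g <;> try omega)
  all_goals (rcases h 0 2 1 with g | g | g | g <;> try omega)
  all_goals (rcases h 1 (-2) 0 with g | g | g | g <;> try omega)
  all_goals (rcases h 1 (-1) 0 with g | g | g | g <;> try omega)
  all_goals (rcases h 1 (-2) (-1) with g | g | g | g <;> try omega)
  all_goals (rcases h 1 (-1) (-1) with g | g | g | g <;> try omega)
  all_goals (rcases h 0 1 1 with g | g | g | g <;> try omega)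
  all_goals (rcases h 1 0 (-1) with g | g | g | g <;> try omega)
  all_goals (rcases h 1 0 0 with g | g | g | g <;> try omega)
  all_goals (rcases h (-1) 4 1 with g | g | g | g <;> try omega)
  all_goals (rcases h 2 (-3) (-1) with g | g | g | g <;> try omega)
  all_goals (rcases h 2 (-4) (-1) with g | g | g | g <;> try omega)

theorem IsLatticeReduced.sum_le_of_four_le_ratio {m n x y w : ℤ} (hn : 1 ≤ n) (h₁ : 4 * n ≤ m)
    (hx : 0 ≤ x) (hy : 0 ≤ y) (hw : 0 ≤ w) (h : IsLatticeReduced m n 2 2 3 x y w) :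
    x + y + w ≤ 5 * m - 3 := by
  by_contra hc
  rcases h 0 1 0 with g | g | g | g <;> try omega
  all_goals (rcases h 0 2 1 with g | g | g | g <;> try omega)
  all_goals (rcases h 1 (-2) 0 with g | g | g | g <;> try omega)
  all_goals (rcases h 0 0 1 with g | g | g | g <;> try omega)
  all_goals (rcases h 1 (-1) 0 with g | g | g | g <;> try omega)
  all_goals (rcases h 1 (-1) (-1) with g | g | g | g <;> try omega)
  all_goals (rcases h 2 (-1) (-2) with g | g | g | g <;> try omega)
  all_goals (rcases h 1 0 (-1) with g | g | g | g <;> try omega)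
  all_goals (rcases h 1 0 0 with g | g | g | g <;> try omega)

theorem exists_MEq_nonneg_sum_le {m n : ℤ} (hm : 1 ≤ m) (hn : 1 ≤ n) (z : Fin 3 → ℤ) :
    ∃ a : Fin 3 → ℤ, MEq (Mmn m n) a z ∧ 0 ≤ a 0 ∧ 0 ≤ a 1 ∧ 0 ≤ a 2 ∧
      a 0 + a 1 + a 2 ≤ max (m + 8 * n - 3) (5 * m - 3) := by
  rcases le_total m n with hmn | hmn
  · obtain ⟨a, haz, h0, h1, h2, h⟩ := exists_MEq_of_le hm hmn z
    exact ⟨a, haz, h0, h1, h2, h.trans (le_max_left _ _)⟩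
  rcases le_total (2 * m) (5 * n) with hmid | hmid
  · obtain ⟨a, haz, h0, h1, h2, h⟩ :=
      exists_MEq_isLatticeReduced hm hn z (p := 9) (q := 8) (r := 8) (by simp) (by simp) (by simp)
    refine ⟨a, haz, h0, h1, h2, ?_⟩
    rcases le_total (3 * m) (5 * n) with hlow | hlow
    · exact (h.sum_le_of_ratio_le_five_thirds hn hmn hlow h0 h1 h2).trans (le_max_left _ _)
    · exact h.sum_le_of_ratio_le_five_halves hn hlow hmid h0 h1 h2
  rcases le_total m (4 * n) with hfour | hfour
  · obtain ⟨a, haz, h0, h1, h2, h⟩ :=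
      exists_MEq_isLatticeReduced hm hn z (p := 17) (q := 16) (r := 16) (by simp) (by simp) (by simp)
    exact ⟨a, haz, h0, h1, h2,
      (h.sum_le_of_ratio_le_four hn hmid hfour h0 h1 h2).trans (le_max_right _ _)⟩
  · obtain ⟨a, haz, h0, h1, h2, h⟩ :=
      exists_MEq_isLatticeReduced hm hn z (p := 2) (q := 2) (r := 3) (by simp) (by simp) (by simp)
    exact ⟨a, haz, h0, h1, h2,
      (h.sum_le_of_four_le_ratio hn hfour h0 h1 h2).trans (le_max_right _ _)⟩

/-- Proposition 6: for positive integers `m, n`, the Cayley digraph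
`G_{M(m,n)}` has order `|det M(m,n)| = m³ + 12m²n + 14mn²` and every `z ∈ ℤ³` is
congruent mod `M(m,n)` to a nonnegative vector of ℓ¹-norm at most
`max{m + 8n - 3, 3m + 4n - 3, 5m - 3}`. -/
theorem Mmn_order_and_diameter (m n : ℤ) (hm : 1 ≤ m) (hn : 1 ≤ n) :
    (((Mmn m n).det.natAbs : ℤ) = m^3 + 12*m^2*n + 14*m*n^2) ∧
    (∀ z : Fin 3 → ℤ, ∃ a : Fin 3 → ℕ,
      MEq (Mmn m n) (fun i => (a i : ℤ)) z ∧
      (∑ i, (a i : ℤ)) ≤ max (m + 8*n - 3) (max (3*m + 4*n - 3) (5*m - 3))) := by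
  refine ⟨?_, fun z => ?_⟩
  · rw [Mmn_det, Int.natAbs_of_nonneg (by positivity)]
  · obtain ⟨a, haz, h0, h1, h2, h⟩ := exists_MEq_nonneg_sum_le hm hn z
    have hcast : (fun i => ((a i).toNat : ℤ)) = a := by
      ext i
      fin_cases i <;> simpa
    refine ⟨fun i => (a i).toNat, ?_, ?_⟩
    · rwa [hcast]
    · have hsum := congrArg (fun b : Fin 3 → ℤ => ∑ i, b i) hcast
      simp only [Fin.sum_univ_three] at hsum ⊢
      omega
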